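/- arXiv:1701.00268 — 2 statements merged into one kernel-verified Lean document; each statement's English description precedes it below -/
import Mathlib

section
/- Consider a commutative three-dimensional diagram of abelian groups consisting of 27 objects X_r^q, where X ∈ {L, M, N} indexes columns, r ∈ {1, 0, 2} indexes rows (written X₁, X, X₂), and q ∈ {′, none, ′′} indexes layers, with homomorphisms in three directions: horizontal L_r^q → M_r^q → N_r^q, vertical X₁^q → X^q → X₂^q, and transversal X_r′ → X_r → X_r′′, all squares commuting. Assume: (1) every three-term line in any of the three directions is exact at its middle term; (2) in every such line the second map is an epimorphism; (3) the three sequences L′′ → M′′ → N′′, M₂′ → M₂ → M₂′′, and N′ → N → N′′ are short exact (first map mono, second epi, exact in the middle). Let α : N₁′′ → N′′ and β : L₂′′ → M₂′′. Then: (a) the following staircase recipes give well-defined homomorphisms: δ_F : ker α → L₂′′ sending x to the image in L₂′′ of the unique l ∈ L′′ whose image in M′′ equals the image of any lift of x in M₁′′; δ_B : ker β → N₂′ sending y to the image under M₂′ → N₂′ of the unique preimage in M₂′ of the image in M₂ of any lift of y in L₂; and δ_R : ker α → N₂′ sending x to the image under N′ → N₂′ of the unique preimage in N′ of the image in N of any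 lift of x in N₁; (b) the image of δ_F is contained in ker β; and (c) δ_B ∘ δ_F = −δ_R as homomorphisms ker α → N₂′. (This is Lemma 4.1: the composition of the connecting homomorphisms of the front and bottom faces equals the negative of the connecting homomorphism of the right-hand face.) -/
/-!
STATEMENT 7 (Lemma 4.1).  A commutative 3D diagram of abelian groups with 27
objects `X_r^q` (columns `X ∈ {L, M, N}`, rows `r ∈ {1, 0, 2}` written
`X1, X, X2`, layers `q ∈ {′, none, ′′}`), maps in three directions
(horizontal `h…`, vertical `v…`, transversal `t…`), all squares commuting.
Hypotheses: (1) every three-term line is exact at its middle term; (2) the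
second map of every line is epic; (3) the lines `L′′ → M′′ → N′′` (front),
`M₂′ → M₂ → M₂′′` (bottom) and `N′ → N → N′′` (right) are short exact.
With `α := vN1'' : N₁′′ → N′′` and `β := hL2'' : L₂′′ → M₂′′`, the staircase
recipes define connecting homomorphisms `δF : ker α → L₂′′` (front face),
`δB : ker β → N₂′` (bottom face), `δR : ker α → N₂′` (right face); the image
of `δF` lies in `ker β`, and `δB ∘ δF = −δR`.
-/

theorem snake_aux {A1 B1 C1 A B C A2 : Type*}
    [AddCommGroup A1] [AddCommGroup B1] [AddCommGroup C1] [AddCommGroup A]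
    [AddCommGroup B] [AddCommGroup C] [AddCommGroup A2]
    (f : A1 →+ B1) (g : B1 →+ C1) (i : A →+ B) (j : B →+ C)
    (a : A1 →+ A) (b : B1 →+ B) (c : C1 →+ C) (p : A →+ A2)
    (s1 : ∀ x, b (f x) = i (a x)) (s2 : ∀ x, c (g x) = j (b x))
    (efg : Function.Exact f g) (eij : Function.Exact i j)
    (hg : Function.Surjective g) (hi : Function.Injective i)
    (hpa : Function.Exact a p) :
    ∃ δ : ↥(AddMonoidHom.ker c) →+ A2,
      ∀ (x : C1) (hx : x ∈ AddMonoidHom.ker c) (m : B1) (l : A),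
        g m = x → i l = b m → δ ⟨x, hx⟩ = p l := by
  have ex : ∀ x : ↥(AddMonoidHom.ker c), ∃ (m : B1) (l : A), g m = x ∧ i l = b m := by
    rintro ⟨x, hx⟩
    obtain ⟨m, rfl⟩ := hg x
    have h0 : j (b m) = 0 := by rw [← s2]; exact hx
    obtain ⟨l, hl⟩ := (eij _).1 h0
    exact ⟨m, l, rfl, hl⟩
  have un : ∀ (m m' : B1) (l l' : A), g m = g m' → i l = b m → i l' = b m' → p l = p l' := by
    intro m m' l l' h h1 h2
    have h0 : g (m - m') = 0 := by rw [map_sub, h, sub_self]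
    obtain ⟨z, hz⟩ := (efg _).1 h0
    have h3 : a z = l - l' := by
      apply hi
      rw [← s1, hz, map_sub, map_sub, h1, h2]
    have h4 : p (l - l') = 0 := by rw [← h3]; exact hpa.apply_apply_eq_zero z
    rwa [map_sub, sub_eq_zero] at h4
  choose m l hm hl using ex
  refine ⟨AddMonoidHom.mk' (fun x => p (l x)) ?_, ?_⟩
  · intro x y
    rw [← map_add]
    refine un (m (x + y)) (m x + m y) _ _ ?_ (hl _) ?_
    · rw [map_add, hm, hm, hm]; rfl
    · rw [map_add, map_add, hl, hl]
  · intro x hx m' l' h1 h2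
    exact un _ _ _ _ ((hm ⟨x, hx⟩).trans h1.symm) (hl _) h2

theorem stmt_7
    {L1' M1' N1' L' M' N' L2' M2' N2' L1 M1 N1 L M N L2 M2 N2 L1'' M1'' N1'' L'' M'' N'' L2'' M2'' N2'' : Type*}
    [AddCommGroup L1'] [AddCommGroup M1'] [AddCommGroup N1'] [AddCommGroup L']
    [AddCommGroup M'] [AddCommGroup N'] [AddCommGroup L2'] [AddCommGroup M2']
    [AddCommGroup N2'] [AddCommGroup L1] [AddCommGroup M1] [AddCommGroup N1]
    [AddCommGroup L] [AddCommGroup M] [AddCommGroup N] [AddCommGroup L2]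
    [AddCommGroup M2] [AddCommGroup N2] [AddCommGroup L1''] [AddCommGroup M1'']
    [AddCommGroup N1''] [AddCommGroup L''] [AddCommGroup M''] [AddCommGroup N'']
    [AddCommGroup L2''] [AddCommGroup M2''] [AddCommGroup N2'']
    -- horizontal maps
    (hL1' : L1' →+ M1')
    (hM1' : M1' →+ N1')
    (hL' : L' →+ M')
    (hM' : M' →+ N')
    (hL2' : L2' →+ M2')
    (hM2' : M2' →+ N2')
    (hL1 : L1 →+ M1)
    (hM1 : M1 →+ N1)
    (hL : L →+ M)
    (hM : M →+ N)
    (hL2 : L2 →+ M2)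
    (hM2 : M2 →+ N2)
    (hL1'' : L1'' →+ M1'')
    (hM1'' : M1'' →+ N1'')
    (hL'' : L'' →+ M'')
    (hM'' : M'' →+ N'')
    (hL2'' : L2'' →+ M2'')
    (hM2'' : M2'' →+ N2'')
    -- vertical maps
    (vL1' : L1' →+ L')
    (vL' : L' →+ L2')
    (vM1' : M1' →+ M')
    (vM' : M' →+ M2')
    (vN1' : N1' →+ N')
    (vN' : N' →+ N2')
    (vL1 : L1 →+ L)
    (vL : L →+ L2)
    (vM1 : M1 →+ M)
    (vM : M →+ M2)
    (vN1 : N1 →+ N)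
    (vN : N →+ N2)
    (vL1'' : L1'' →+ L'')
    (vL'' : L'' →+ L2'')
    (vM1'' : M1'' →+ M'')
    (vM'' : M'' →+ M2'')
    (vN1'' : N1'' →+ N'')
    (vN'' : N'' →+ N2'')
    -- transversal maps
    (tL1' : L1' →+ L1)
    (tL1 : L1 →+ L1'')
    (tL' : L' →+ L)
    (tL : L →+ L'')
    (tL2' : L2' →+ L2)
    (tL2 : L2 →+ L2'')
    (tM1' : M1' →+ M1)
    (tM1 : M1 →+ M1'')
    (tM' : M' →+ M)
    (tM : M →+ M'')
    (tM2' : M2' →+ M2)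
    (tM2 : M2 →+ M2'')
    (tN1' : N1' →+ N1)
    (tN1 : N1 →+ N1'')
    (tN' : N' →+ N)
    (tN : N →+ N'')
    (tN2' : N2' →+ N2)
    (tN2 : N2 →+ N2'')
    -- commutativity of all squares
    (hv1 : ∀ x : L1', vM1' (hL1' x) = hL' (vL1' x))
    (hv2 : ∀ x : L', vM' (hL' x) = hL2' (vL' x))
    (hv3 : ∀ x : M1', vN1' (hM1' x) = hM' (vM1' x))
    (hv4 : ∀ x : M', vN' (hM' x) = hM2' (vM' x))
    (hv5 : ∀ x : L1, vM1 (hL1 x) = hL (vL1 x))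
    (hv6 : ∀ x : L, vM (hL x) = hL2 (vL x))
    (hv7 : ∀ x : M1, vN1 (hM1 x) = hM (vM1 x))
    (hv8 : ∀ x : M, vN (hM x) = hM2 (vM x))
    (hv9 : ∀ x : L1'', vM1'' (hL1'' x) = hL'' (vL1'' x))
    (hv10 : ∀ x : L'', vM'' (hL'' x) = hL2'' (vL'' x))
    (hv11 : ∀ x : M1'', vN1'' (hM1'' x) = hM'' (vM1'' x))
    (hv12 : ∀ x : M'', vN'' (hM'' x) = hM2'' (vM'' x))
    (ht1 : ∀ x : L1', tM1' (hL1' x) = hL1 (tL1' x))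
    (ht2 : ∀ x : L1, tM1 (hL1 x) = hL1'' (tL1 x))
    (ht3 : ∀ x : M1', tN1' (hM1' x) = hM1 (tM1' x))
    (ht4 : ∀ x : M1, tN1 (hM1 x) = hM1'' (tM1 x))
    (ht5 : ∀ x : L', tM' (hL' x) = hL (tL' x))
    (ht6 : ∀ x : L, tM (hL x) = hL'' (tL x))
    (ht7 : ∀ x : M', tN' (hM' x) = hM (tM' x))
    (ht8 : ∀ x : M, tN (hM x) = hM'' (tM x))
    (ht9 : ∀ x : L2', tM2' (hL2' x) = hL2 (tL2' x))
    (ht10 : ∀ x : L2, tM2 (hL2 x) = hL2'' (tL2 x))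
    (ht11 : ∀ x : M2', tN2' (hM2' x) = hM2 (tM2' x))
    (ht12 : ∀ x : M2, tN2 (hM2 x) = hM2'' (tM2 x))
    (vt1 : ∀ x : L1', tL' (vL1' x) = vL1 (tL1' x))
    (vt2 : ∀ x : L1, tL (vL1 x) = vL1'' (tL1 x))
    (vt3 : ∀ x : L', tL2' (vL' x) = vL (tL' x))
    (vt4 : ∀ x : L, tL2 (vL x) = vL'' (tL x))
    (vt5 : ∀ x : M1', tM' (vM1' x) = vM1 (tM1' x))
    (vt6 : ∀ x : M1, tM (vM1 x) = vM1'' (tM1 x))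
    (vt7 : ∀ x : M', tM2' (vM' x) = vM (tM' x))
    (vt8 : ∀ x : M, tM2 (vM x) = vM'' (tM x))
    (vt9 : ∀ x : N1', tN' (vN1' x) = vN1 (tN1' x))
    (vt10 : ∀ x : N1, tN (vN1 x) = vN1'' (tN1 x))
    (vt11 : ∀ x : N', tN2' (vN' x) = vN (tN' x))
    (vt12 : ∀ x : N, tN2 (vN x) = vN'' (tN x))
    -- (1) every three-term line is exact at its middle term
    (exh1 : Function.Exact ⇑(hL1') ⇑(hM1'))
    (exh2 : Function.Exact ⇑(hL') ⇑(hM'))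
    (exh3 : Function.Exact ⇑(hL2') ⇑(hM2'))
    (exh4 : Function.Exact ⇑(hL1) ⇑(hM1))
    (exh5 : Function.Exact ⇑(hL) ⇑(hM))
    (exh6 : Function.Exact ⇑(hL2) ⇑(hM2))
    (exh7 : Function.Exact ⇑(hL1'') ⇑(hM1''))
    (exh8 : Function.Exact ⇑(hL'') ⇑(hM''))
    (exh9 : Function.Exact ⇑(hL2'') ⇑(hM2''))
    (exv1 : Function.Exact ⇑(vL1') ⇑(vL'))
    (exv2 : Function.Exact ⇑(vM1') ⇑(vM'))
    (exv3 : Function.Exact ⇑(vN1') ⇑(vN'))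
    (exv4 : Function.Exact ⇑(vL1) ⇑(vL))
    (exv5 : Function.Exact ⇑(vM1) ⇑(vM))
    (exv6 : Function.Exact ⇑(vN1) ⇑(vN))
    (exv7 : Function.Exact ⇑(vL1'') ⇑(vL''))
    (exv8 : Function.Exact ⇑(vM1'') ⇑(vM''))
    (exv9 : Function.Exact ⇑(vN1'') ⇑(vN''))
    (ext1 : Function.Exact ⇑(tL1') ⇑(tL1))
    (ext2 : Function.Exact ⇑(tL') ⇑(tL))
    (ext3 : Function.Exact ⇑(tL2') ⇑(tL2))
    (ext4 : Function.Exact ⇑(tM1') ⇑(tM1))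
    (ext5 : Function.Exact ⇑(tM') ⇑(tM))
    (ext6 : Function.Exact ⇑(tM2') ⇑(tM2))
    (ext7 : Function.Exact ⇑(tN1') ⇑(tN1))
    (ext8 : Function.Exact ⇑(tN') ⇑(tN))
    (ext9 : Function.Exact ⇑(tN2') ⇑(tN2))
    -- (2) in every line the second map is an epimorphism
    (eph1 : Function.Surjective ⇑(hM1'))
    (eph2 : Function.Surjective ⇑(hM'))
    (eph3 : Function.Surjective ⇑(hM2'))
    (eph4 : Function.Surjective ⇑(hM1))
    (eph5 : Function.Surjective ⇑(hM))
    (eph6 : Function.Surjective ⇑(hM2))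
    (eph7 : Function.Surjective ⇑(hM1''))
    (eph8 : Function.Surjective ⇑(hM''))
    (eph9 : Function.Surjective ⇑(hM2''))
    (epv1 : Function.Surjective ⇑(vL'))
    (epv2 : Function.Surjective ⇑(vM'))
    (epv3 : Function.Surjective ⇑(vN'))
    (epv4 : Function.Surjective ⇑(vL))
    (epv5 : Function.Surjective ⇑(vM))
    (epv6 : Function.Surjective ⇑(vN))
    (epv7 : Function.Surjective ⇑(vL''))
    (epv8 : Function.Surjective ⇑(vM''))
    (epv9 : Function.Surjective ⇑(vN''))
    (ept1 : Function.Surjective ⇑(tL1))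
    (ept2 : Function.Surjective ⇑(tL))
    (ept3 : Function.Surjective ⇑(tL2))
    (ept4 : Function.Surjective ⇑(tM1))
    (ept5 : Function.Surjective ⇑(tM))
    (ept6 : Function.Surjective ⇑(tM2))
    (ept7 : Function.Surjective ⇑(tN1))
    (ept8 : Function.Surjective ⇑(tN))
    (ept9 : Function.Surjective ⇑(tN2))
    -- (3) the three distinguished lines are short exact: first maps are monic
    (monoF : Function.Injective ⇑(hL''))
    (monoBt : Function.Injective ⇑(tM2'))
    (monoR : Function.Injective ⇑(tN')):
    -- (a) the three staircase recipes define homomorphisms δF, δB, δR; moreover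
    -- (b) the image of δF lies in ker (hL2'' : L₂′′ → M₂′′), and
    -- (c) δB ∘ δF = − δR
    ∃ (δF : ↥(AddMonoidHom.ker vN1'') →+ L2'')
      (δB : ↥(AddMonoidHom.ker hL2'') →+ N2')
      (δR : ↥(AddMonoidHom.ker vN1'') →+ N2'),
      -- δF : the connecting homomorphism of the front face
      (∀ (x : N1'') (hx : x ∈ AddMonoidHom.ker vN1'') (m : M1'') (l : L''),
        hM1'' m = x → hL'' l = vM1'' m → δF ⟨x, hx⟩ = vL'' l) ∧
      -- δB : the connecting homomorphism of the bottom face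
      (∀ (y : L2'') (hy : y ∈ AddMonoidHom.ker hL2'') (l : L2) (m : M2'),
        tL2 l = y → tM2' m = hL2 l → δB ⟨y, hy⟩ = hM2' m) ∧
      -- δR : the connecting homomorphism of the right-hand face
      (∀ (x : N1'') (hx : x ∈ AddMonoidHom.ker vN1'') (n : N1) (n' : N'),
        tN1 n = x → tN' n' = vN1 n → δR ⟨x, hx⟩ = vN' n') ∧
      -- (b)
      (∀ (x : N1'') (hx : x ∈ AddMonoidHom.ker vN1''), hL2'' (δF ⟨x, hx⟩) = 0) ∧
      -- (c)
      (∀ (x : N1'') (hx : x ∈ AddMonoidHom.ker vN1''),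
        ∃ h2 : δF ⟨x, hx⟩ ∈ AddMonoidHom.ker hL2'',
          δB ⟨δF ⟨x, hx⟩, h2⟩ = - δR ⟨x, hx⟩) := by
  obtain ⟨δF, hF⟩ := snake_aux hL1'' hM1'' hL'' hM'' vL1'' vM1'' vN1'' vL''
    hv9 hv11 exh7 exh8 eph7 monoF exv7
  obtain ⟨δB, hB⟩ := snake_aux tL2' tL2 tM2' tM2 hL2' hL2 hL2'' hM2'
    (fun x => (ht9 x).symm) (fun x => (ht10 x).symm) ext3 ext6 ept3 monoBt exh3
  obtain ⟨δR, hR⟩ := snake_aux tN1' tN1 tN' tN vN1' vN1 vN1'' vN'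
    (fun x => (vt9 x).symm) (fun x => (vt10 x).symm) ext7 ext8 ept7 monoR exv3
  have key : ∀ (x : N1'') (hx : x ∈ AddMonoidHom.ker vN1''),
      ∃ h2 : δF ⟨x, hx⟩ ∈ AddMonoidHom.ker hL2'',
          δB ⟨δF ⟨x, hx⟩, h2⟩ = - δR ⟨x, hx⟩ := by
    intro x hx
    obtain ⟨n, hn⟩ := ept7 x
    obtain ⟨m1, rfl⟩ := eph4 n
    have e1 : hM1'' (tM1 m1) = x := by rw [← ht4, hn]
    have h0 : hM'' (vM1'' (tM1 m1)) = 0 := by rw [← hv11, e1]; exact hx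
    obtain ⟨l'', hl''⟩ := (exh8 _).1 h0
    obtain ⟨l, rfl⟩ := ept2 l''
    have e2 : tM (vM1 m1 - hL l) = 0 := by rw [map_sub, vt6, ht6, hl'', sub_self]
    obtain ⟨m', hm'⟩ := (ext5 _).1 e2
    have eF := hF x hx _ _ e1 hl''
    have eR := hR x hx (hM1 m1) (hM' m') hn (by
      rw [ht7, hm', map_sub, exh5.apply_apply_eq_zero, sub_zero, hv7])
    have h2 : δF ⟨x, hx⟩ ∈ AddMonoidHom.ker hL2'' := by
      rw [AddMonoidHom.mem_ker, eF, ← hv10, hl'', exv8.apply_apply_eq_zero]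
    refine ⟨h2, ?_⟩
    rw [hB _ h2 (vL l) (-(vM' m')) (by rw [eF, vt4]) (by
      rw [map_neg, vt7, hm', map_sub, exv5.apply_apply_eq_zero, zero_sub, neg_neg, hv6]),
      eR, map_neg, hv4]
  exact ⟨δF, δB, δR, hF, hB, hR, fun x hx => (key x hx).1, key⟩
end

section
/- Consider a commutative three-dimensional diagram of abelian groups consisting of 27 objects X_r^q, where X ∈ {L, M, N} indexes columns, r ∈ {1, 0, 2} indexes rows (written X₁, X, X₂), and q ∈ {′, none, ′′} indexes layers, with homomorphisms in three directions: horizontal L_r^q → M_r^q → N_r^q, vertical X₁^q → X^q → X₂^q, and transversal X_r′ → X_r → X_r′′, all squares commuting. Assume: (1) every three-term line in any of the three directions is exact at its middle term; (2) in every such line the second map is an epimorphism; (3) the five sequences M₁′ → M₁ → M₁′′, L′ → M′ → N′, L′ → L → L′′, L → M → N, and M′ → M → M′′ are short exact (first map mono, second epi, exact in the middle). Let α : L₁′′ → M₁′′, γ : L₁′′ → L′′, and β : N₁′ → N′. Then: (a) the following staircase recipes give well-defined homomorphisms: δ_T : ker α → N₁′ sending x to the image under M₁′ → N₁′ of the unique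 preimage in M₁′ of the horizontal image in M₁ of any transversal lift of x in L₁; δ_Bk : ker β → L₂′ sending z to the image under L′ → L₂′ of the unique preimage in L′ of the vertical image in M′ of any horizontal lift of z in M₁′; and δ_L : ker γ → L₂′ sending x to the image under L′ → L₂′ of the unique preimage in L′ of the vertical image in L of any transversal lift of x in L₁; (b) δ_T maps ker α ∩ ker γ into ker β; and (c) δ_Bk ∘ δ_T = δ_L on ker α ∩ ker γ. (This is Lemma 4.2: on ker α ∩ ker γ, the composition of the connecting homomorphisms of the top and back faces coincides with the connecting homomorphism of the left-hand face.) -/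
/-!
STATEMENT 8 (Lemma 4.2).  A commutative 3D diagram of abelian groups with 27
objects `X_r^q` (columns `X ∈ {L, M, N}`, rows `r ∈ {1, 0, 2}` written
`X1, X, X2`, layers `q ∈ {′, none, ′′}`), maps in three directions
(horizontal `h…`, vertical `v…`, transversal `t…`), all squares commuting.
Hypotheses: (1) every three-term line is exact at its middle term; (2) the
second map of every line is epic; (3) the lines `M₁′ → M₁ → M₁′′` (top),
`L′ → M′ → N′` (back), `L′ → L → L′′` (left), `L → M → N` and `M′ → M → M′′`
are short exact.  With `α := hL1'' : L₁′′ → M₁′′`, `γ := vL1'' : L₁′′ → L′′`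
and `β := vN1' : N₁′ → N′`, the staircase recipes define connecting
homomorphisms `δT : ker α → N₁′` (top face), `δBk : ker β → L₂′` (back face),
`δL : ker γ → L₂′` (left face); `δT` maps `ker α ∩ ker γ` into `ker β`, and
`δBk ∘ δT = δL` on `ker α ∩ ker γ`.
-/

theorem snake_aux_s8 {A' A A'' B' B B'' C : Type*}
    [AddCommGroup A'] [AddCommGroup A] [AddCommGroup A''] [AddCommGroup B']
    [AddCommGroup B] [AddCommGroup B''] [AddCommGroup C]
    (i : A' →+ A) (p : A →+ A'') (j : B' →+ B) (q : B →+ B'')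
    (f' : A' →+ B') (f : A →+ B) (f'' : A'' →+ B'') (g : B' →+ C)
    (c1 : ∀ x, j (f' x) = f (i x)) (c2 : ∀ x, q (f x) = f'' (p x))
    (e1 : Function.Exact i p) (e2 : Function.Exact j q) (e3 : Function.Exact f' g)
    (hp : Function.Surjective p) (hj : Function.Injective j) :
    ∃ δ : ↥(AddMonoidHom.ker f'') →+ C,
      ∀ (x : A'') (hx : x ∈ AddMonoidHom.ker f'') (a : A) (b : B'),
        p a = x → j b = f a → δ ⟨x, hx⟩ = g b := by
  have ex : ∀ x : ↥(AddMonoidHom.ker f''), ∃ a : A, ∃ b : B', p a = x ∧ j b = f a := by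
    rintro ⟨x, hx⟩
    obtain ⟨a, rfl⟩ := hp x
    have h : q (f a) = 0 := by rw [c2]; exact hx
    obtain ⟨b, hb⟩ := (e2 _).1 h
    exact ⟨a, b, rfl, hb⟩
  have un : ∀ (a : A) (b : B'), p a = 0 → j b = f a → g b = 0 := by
    intro a b ha hb
    obtain ⟨a', rfl⟩ := (e1 _).1 ha
    rw [← c1] at hb
    rw [hj hb]
    exact (e3 _).2 ⟨a', rfl⟩
  choose a b ha hb using ex
  have key : ∀ (x : ↥(AddMonoidHom.ker f'')) (a₁ : A) (b₁ : B'),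
      p a₁ = x → j b₁ = f a₁ → g (b x) = g b₁ := by
    intro x a₁ b₁ h1 h2
    have := un (a x - a₁) (b x - b₁) (by rw [map_sub, ha, h1, sub_self])
      (by rw [map_sub, map_sub, hb, h2])
    rwa [map_sub, sub_eq_zero] at this
  refine ⟨AddMonoidHom.mk' (fun x => g (b x)) ?_, ?_⟩
  · intro x y
    rw [← map_add]
    refine key _ (a x + a y) _ ?_ ?_
    · rw [map_add, ha, ha]; rfl
    · rw [map_add, map_add, hb, hb]
  · intro x hx a₁ b₁ h1 h2
    exact key ⟨x, hx⟩ a₁ b₁ h1 h2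

theorem stmt_8
    {L1' M1' N1' L' M' N' L2' M2' N2' L1 M1 N1 L M N L2 M2 N2 L1'' M1'' N1'' L'' M'' N'' L2'' M2'' N2'' : Type*}
    [AddCommGroup L1'] [AddCommGroup M1'] [AddCommGroup N1'] [AddCommGroup L']
    [AddCommGroup M'] [AddCommGroup N'] [AddCommGroup L2'] [AddCommGroup M2']
    [AddCommGroup N2'] [AddCommGroup L1] [AddCommGroup M1] [AddCommGroup N1]
    [AddCommGroup L] [AddCommGroup M] [AddCommGroup N] [AddCommGroup L2]
    [AddCommGroup M2] [AddCommGroup N2] [AddCommGroup L1''] [AddCommGroup M1'']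
    [AddCommGroup N1''] [AddCommGroup L''] [AddCommGroup M''] [AddCommGroup N'']
    [AddCommGroup L2''] [AddCommGroup M2''] [AddCommGroup N2'']
    -- horizontal maps
    (hL1' : L1' →+ M1')
    (hM1' : M1' →+ N1')
    (hL' : L' →+ M')
    (hM' : M' →+ N')
    (hL2' : L2' →+ M2')
    (hM2' : M2' →+ N2')
    (hL1 : L1 →+ M1)
    (hM1 : M1 →+ N1)
    (hL : L →+ M)
    (hM : M →+ N)
    (hL2 : L2 →+ M2)
    (hM2 : M2 →+ N2)
    (hL1'' : L1'' →+ M1'')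
    (hM1'' : M1'' →+ N1'')
    (hL'' : L'' →+ M'')
    (hM'' : M'' →+ N'')
    (hL2'' : L2'' →+ M2'')
    (hM2'' : M2'' →+ N2'')
    -- vertical maps
    (vL1' : L1' →+ L')
    (vL' : L' →+ L2')
    (vM1' : M1' →+ M')
    (vM' : M' →+ M2')
    (vN1' : N1' →+ N')
    (vN' : N' →+ N2')
    (vL1 : L1 →+ L)
    (vL : L →+ L2)
    (vM1 : M1 →+ M)
    (vM : M →+ M2)
    (vN1 : N1 →+ N)
    (vN : N →+ N2)
    (vL1'' : L1'' →+ L'')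
    (vL'' : L'' →+ L2'')
    (vM1'' : M1'' →+ M'')
    (vM'' : M'' →+ M2'')
    (vN1'' : N1'' →+ N'')
    (vN'' : N'' →+ N2'')
    -- transversal maps
    (tL1' : L1' →+ L1)
    (tL1 : L1 →+ L1'')
    (tL' : L' →+ L)
    (tL : L →+ L'')
    (tL2' : L2' →+ L2)
    (tL2 : L2 →+ L2'')
    (tM1' : M1' →+ M1)
    (tM1 : M1 →+ M1'')
    (tM' : M' →+ M)
    (tM : M →+ M'')
    (tM2' : M2' →+ M2)
    (tM2 : M2 →+ M2'')
    (tN1' : N1' →+ N1)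
    (tN1 : N1 →+ N1'')
    (tN' : N' →+ N)
    (tN : N →+ N'')
    (tN2' : N2' →+ N2)
    (tN2 : N2 →+ N2'')
    -- commutativity of all squares
    (hv1 : ∀ x : L1', vM1' (hL1' x) = hL' (vL1' x))
    (hv2 : ∀ x : L', vM' (hL' x) = hL2' (vL' x))
    (hv3 : ∀ x : M1', vN1' (hM1' x) = hM' (vM1' x))
    (hv4 : ∀ x : M', vN' (hM' x) = hM2' (vM' x))
    (hv5 : ∀ x : L1, vM1 (hL1 x) = hL (vL1 x))
    (hv6 : ∀ x : L, vM (hL x) = hL2 (vL x))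
    (hv7 : ∀ x : M1, vN1 (hM1 x) = hM (vM1 x))
    (hv8 : ∀ x : M, vN (hM x) = hM2 (vM x))
    (hv9 : ∀ x : L1'', vM1'' (hL1'' x) = hL'' (vL1'' x))
    (hv10 : ∀ x : L'', vM'' (hL'' x) = hL2'' (vL'' x))
    (hv11 : ∀ x : M1'', vN1'' (hM1'' x) = hM'' (vM1'' x))
    (hv12 : ∀ x : M'', vN'' (hM'' x) = hM2'' (vM'' x))
    (ht1 : ∀ x : L1', tM1' (hL1' x) = hL1 (tL1' x))
    (ht2 : ∀ x : L1, tM1 (hL1 x) = hL1'' (tL1 x))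
    (ht3 : ∀ x : M1', tN1' (hM1' x) = hM1 (tM1' x))
    (ht4 : ∀ x : M1, tN1 (hM1 x) = hM1'' (tM1 x))
    (ht5 : ∀ x : L', tM' (hL' x) = hL (tL' x))
    (ht6 : ∀ x : L, tM (hL x) = hL'' (tL x))
    (ht7 : ∀ x : M', tN' (hM' x) = hM (tM' x))
    (ht8 : ∀ x : M, tN (hM x) = hM'' (tM x))
    (ht9 : ∀ x : L2', tM2' (hL2' x) = hL2 (tL2' x))
    (ht10 : ∀ x : L2, tM2 (hL2 x) = hL2'' (tL2 x))
    (ht11 : ∀ x : M2', tN2' (hM2' x) = hM2 (tM2' x))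
    (ht12 : ∀ x : M2, tN2 (hM2 x) = hM2'' (tM2 x))
    (vt1 : ∀ x : L1', tL' (vL1' x) = vL1 (tL1' x))
    (vt2 : ∀ x : L1, tL (vL1 x) = vL1'' (tL1 x))
    (vt3 : ∀ x : L', tL2' (vL' x) = vL (tL' x))
    (vt4 : ∀ x : L, tL2 (vL x) = vL'' (tL x))
    (vt5 : ∀ x : M1', tM' (vM1' x) = vM1 (tM1' x))
    (vt6 : ∀ x : M1, tM (vM1 x) = vM1'' (tM1 x))
    (vt7 : ∀ x : M', tM2' (vM' x) = vM (tM' x))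
    (vt8 : ∀ x : M, tM2 (vM x) = vM'' (tM x))
    (vt9 : ∀ x : N1', tN' (vN1' x) = vN1 (tN1' x))
    (vt10 : ∀ x : N1, tN (vN1 x) = vN1'' (tN1 x))
    (vt11 : ∀ x : N', tN2' (vN' x) = vN (tN' x))
    (vt12 : ∀ x : N, tN2 (vN x) = vN'' (tN x))
    -- (1) every three-term line is exact at its middle term
    (exh1 : Function.Exact ⇑(hL1') ⇑(hM1'))
    (exh2 : Function.Exact ⇑(hL') ⇑(hM'))
    (exh3 : Function.Exact ⇑(hL2') ⇑(hM2'))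
    (exh4 : Function.Exact ⇑(hL1) ⇑(hM1))
    (exh5 : Function.Exact ⇑(hL) ⇑(hM))
    (exh6 : Function.Exact ⇑(hL2) ⇑(hM2))
    (exh7 : Function.Exact ⇑(hL1'') ⇑(hM1''))
    (exh8 : Function.Exact ⇑(hL'') ⇑(hM''))
    (exh9 : Function.Exact ⇑(hL2'') ⇑(hM2''))
    (exv1 : Function.Exact ⇑(vL1') ⇑(vL'))
    (exv2 : Function.Exact ⇑(vM1') ⇑(vM'))
    (exv3 : Function.Exact ⇑(vN1') ⇑(vN'))
    (exv4 : Function.Exact ⇑(vL1) ⇑(vL))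
    (exv5 : Function.Exact ⇑(vM1) ⇑(vM))
    (exv6 : Function.Exact ⇑(vN1) ⇑(vN))
    (exv7 : Function.Exact ⇑(vL1'') ⇑(vL''))
    (exv8 : Function.Exact ⇑(vM1'') ⇑(vM''))
    (exv9 : Function.Exact ⇑(vN1'') ⇑(vN''))
    (ext1 : Function.Exact ⇑(tL1') ⇑(tL1))
    (ext2 : Function.Exact ⇑(tL') ⇑(tL))
    (ext3 : Function.Exact ⇑(tL2') ⇑(tL2))
    (ext4 : Function.Exact ⇑(tM1') ⇑(tM1))
    (ext5 : Function.Exact ⇑(tM') ⇑(tM))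
    (ext6 : Function.Exact ⇑(tM2') ⇑(tM2))
    (ext7 : Function.Exact ⇑(tN1') ⇑(tN1))
    (ext8 : Function.Exact ⇑(tN') ⇑(tN))
    (ext9 : Function.Exact ⇑(tN2') ⇑(tN2))
    -- (2) in every line the second map is an epimorphism
    (eph1 : Function.Surjective ⇑(hM1'))
    (eph2 : Function.Surjective ⇑(hM'))
    (eph3 : Function.Surjective ⇑(hM2'))
    (eph4 : Function.Surjective ⇑(hM1))
    (eph5 : Function.Surjective ⇑(hM))
    (eph6 : Function.Surjective ⇑(hM2))
    (eph7 : Function.Surjective ⇑(hM1''))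
    (eph8 : Function.Surjective ⇑(hM''))
    (eph9 : Function.Surjective ⇑(hM2''))
    (epv1 : Function.Surjective ⇑(vL'))
    (epv2 : Function.Surjective ⇑(vM'))
    (epv3 : Function.Surjective ⇑(vN'))
    (epv4 : Function.Surjective ⇑(vL))
    (epv5 : Function.Surjective ⇑(vM))
    (epv6 : Function.Surjective ⇑(vN))
    (epv7 : Function.Surjective ⇑(vL''))
    (epv8 : Function.Surjective ⇑(vM''))
    (epv9 : Function.Surjective ⇑(vN''))
    (ept1 : Function.Surjective ⇑(tL1))
    (ept2 : Function.Surjective ⇑(tL))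
    (ept3 : Function.Surjective ⇑(tL2))
    (ept4 : Function.Surjective ⇑(tM1))
    (ept5 : Function.Surjective ⇑(tM))
    (ept6 : Function.Surjective ⇑(tM2))
    (ept7 : Function.Surjective ⇑(tN1))
    (ept8 : Function.Surjective ⇑(tN))
    (ept9 : Function.Surjective ⇑(tN2))
    -- (3) the five distinguished lines are short exact: first maps are monic
    (monoT : Function.Injective ⇑(tM1'))
    (monoBk : Function.Injective ⇑(hL'))
    (monoL : Function.Injective ⇑(tL'))
    (monoMid1 : Function.Injective ⇑(hL))
    (monoMid2 : Function.Injective ⇑(tM')):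
    -- (a) the three staircase recipes define homomorphisms δT, δBk, δL; moreover
    -- (b) δT maps ker α ∩ ker γ into ker β, and (c) δBk ∘ δT = δL there
    ∃ (δT : ↥(AddMonoidHom.ker hL1'') →+ N1')
      (δBk : ↥(AddMonoidHom.ker vN1') →+ L2')
      (δL : ↥(AddMonoidHom.ker vL1'') →+ L2'),
      -- δT : the connecting homomorphism of the top face
      (∀ (x : L1'') (hx : x ∈ AddMonoidHom.ker hL1'') (l : L1) (m : M1'),
        tL1 l = x → tM1' m = hL1 l → δT ⟨x, hx⟩ = hM1' m) ∧
      -- δBk : the connecting homomorphism of the back face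
      (∀ (z : N1') (hz : z ∈ AddMonoidHom.ker vN1') (m : M1') (l : L'),
        hM1' m = z → hL' l = vM1' m → δBk ⟨z, hz⟩ = vL' l) ∧
      -- δL : the connecting homomorphism of the left-hand face
      (∀ (x : L1'') (hx : x ∈ AddMonoidHom.ker vL1'') (l : L1) (l' : L'),
        tL1 l = x → tL' l' = vL1 l → δL ⟨x, hx⟩ = vL' l') ∧
      -- (b)
      (∀ (x : L1'') (hx : x ∈ AddMonoidHom.ker hL1'') (hx' : x ∈ AddMonoidHom.ker vL1''),
        vN1' (δT ⟨x, hx⟩) = 0) ∧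
      -- (c)
      (∀ (x : L1'') (hx : x ∈ AddMonoidHom.ker hL1'') (hx' : x ∈ AddMonoidHom.ker vL1''),
        ∃ h2 : δT ⟨x, hx⟩ ∈ AddMonoidHom.ker vN1',
          δBk ⟨δT ⟨x, hx⟩, h2⟩ = δL ⟨x, hx'⟩) := by
  obtain ⟨δT, hT⟩ := snake_aux_s8 tL1' tL1 tM1' tM1 hL1' hL1 hL1'' hM1' ht1 ht2 ext1 ext4 exh1 ept1 monoT
  obtain ⟨δBk, hB⟩ := snake_aux_s8 hL1' hM1' hL' hM' vL1' vM1' vN1' vL'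
    (fun x => (hv1 x).symm) (fun x => (hv3 x).symm) exh1 exh2 exv1 eph1 monoBk
  obtain ⟨δL, hLL⟩ := snake_aux_s8 tL1' tL1 tL' tL vL1' vL1 vL1'' vL' vt1 vt2 ext1 ext2 exv1 ept1 monoL
  have main : ∀ (x : L1'') (hx : x ∈ AddMonoidHom.ker hL1'') (hx' : x ∈ AddMonoidHom.ker vL1''),
      ∃ (m : M1') (l' : L'), δT ⟨x, hx⟩ = hM1' m ∧ hL' l' = vM1' m ∧ δL ⟨x, hx'⟩ = vL' l' := by
    intro x hx hx'
    obtain ⟨l, rfl⟩ := ept1 x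
    have h1 : tM1 (hL1 l) = 0 := by rw [ht2]; exact hx
    have h2 : tL (vL1 l) = 0 := by rw [vt2]; exact hx'
    obtain ⟨m, hm⟩ := (ext4 _).1 h1
    obtain ⟨l', hl'⟩ := (ext2 _).1 h2
    refine ⟨m, l', hT _ hx l m rfl hm, ?_, hLL _ hx' l l' rfl hl'⟩
    apply monoMid2
    rw [ht5, vt5, hm, hl', hv5]
  have hb : ∀ (x : L1'') (hx : x ∈ AddMonoidHom.ker hL1'') (hx' : x ∈ AddMonoidHom.ker vL1''),
      vN1' (δT ⟨x, hx⟩) = 0 := by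
    intro x hx hx'
    obtain ⟨m, l', h1, h2, -⟩ := main x hx hx'
    rw [h1, hv3, ← h2]
    exact (exh2 _).2 ⟨l', rfl⟩
  refine ⟨δT, δBk, δL, hT, hB, hLL, hb, ?_⟩
  intro x hx hx'
  obtain ⟨m, l', h1, h2, h3⟩ := main x hx hx'
  refine ⟨hb x hx hx', ?_⟩
  rw [h3]
  exact hB _ _ m l' h1.symm h2
end
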